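/- There exist ε > 0 and a constant C > 0 such that for every parameter w = (a,b) with |a_k − a*_k| < ε for 2 ≤ k ≤ K*, 0 ≤ a_k < ε for K* < k ≤ K, ‖b_k − b*_k‖ < ε for 1 ≤ k ≤ K*, and b_k ∈ ℝ^N arbitrary for K* < k ≤ K, one has ∫_{ℝ^N} ( p(x|w) − q(x) )² dx ≤ C·[ Σ_{k=2}^{K*} (a_k − a*_k)² + Σ_{k=K*+1}^{K} a_k² + Σ_{k=1}^{K*} ‖b_k − b*_k‖² ]. -/

import Mathlib

open MeasureTheory

/-- The `N`-dimensional Gaussian density with mean `b` and identity covariance. -/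
noncomputable def gaussDensity (N : ℕ) (b x : EuclideanSpace ℝ (Fin N)) : ℝ :=
  (2 * Real.pi) ^ (-(N : ℝ) / 2) * Real.exp (-‖x - b‖ ^ 2 / 2)

/-- The product of two Gaussian densities is a multiple of a squared density at the midpoint. -/
lemma gaussDensity_mul (N : ℕ) (b c x : EuclideanSpace ℝ (Fin N)) :
    gaussDensity N b x * gaussDensity N c x =
      Real.exp (-‖b - c‖ ^ 2 / 4) * gaussDensity N 0 (x - midpoint ℝ b c) ^ 2 := by
  have key : ‖x - b‖ ^ 2 + ‖x - c‖ ^ 2 =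
      2 * ‖x - midpoint ℝ b c‖ ^ 2 + ‖b - c‖ ^ 2 / 2 := by
    have h := parallelogram_law_with_norm ℝ (x - b) (x - c)
    have h1 : x - b + (x - c) = (2 : ℝ) • (x - midpoint ℝ b c) := by
      rw [midpoint_eq_smul_add, invOf_eq_inv]; module
    have h2 : x - b - (x - c) = c - b := by abel
    rw [h1, h2, norm_smul, norm_sub_rev c b] at h
    norm_num at h
    nlinarith
  unfold gaussDensity
  rw [sub_zero, mul_pow, mul_mul_mul_comm, ← Real.exp_add, ← Real.exp_nat_mul, mul_left_comm,
    ← Real.exp_add, ← sq]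
  congr 2
  push_cast
  linarith

lemma integrable_gaussDensity_zero_sq (N : ℕ) :
    Integrable fun x => gaussDensity N 0 x ^ 2 := by
  have h := (GaussianFourier.integrable_cexp_neg_mul_sq_norm_add
    (V := EuclideanSpace ℝ (Fin N)) (b := 1) (by simp) 0 0).re
  refine (h.const_mul (((2 * Real.pi) ^ (-(N : ℝ) / 2)) ^ 2)).congr (.of_forall fun x => ?_)
  have : (Complex.exp (-(‖x‖ : ℂ) ^ 2)).re = Real.exp (-‖x‖ ^ 2) := by
    rw [← Complex.exp_ofReal_re]; push_cast; rfl
  simp only [gaussDensity, sub_zero, mul_pow, ← Real.exp_nat_mul]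
  simp [this]
  left
  ring

lemma continuous_gaussDensity (N : ℕ) (b : EuclideanSpace ℝ (Fin N)) :
    Continuous (gaussDensity N b) := by
  unfold gaussDensity
  fun_prop

lemma integrable_gaussDensity_mul (N : ℕ) (b c : EuclideanSpace ℝ (Fin N)) :
    Integrable fun x => gaussDensity N b x * gaussDensity N c x := by
  simp only [gaussDensity_mul]
  exact ((integrable_gaussDensity_zero_sq N).comp_sub_right _).const_mul _

lemma integral_gaussDensity_mul (N : ℕ) (b c : EuclideanSpace ℝ (Fin N)) :
    ∫ x, gaussDensity N b x * gaussDensity N c x =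
      Real.exp (-‖b - c‖ ^ 2 / 4) * ∫ x, gaussDensity N 0 x ^ 2 := by
  simp only [gaussDensity_mul]
  rw [integral_const_mul, integral_sub_right_eq_self (fun x => gaussDensity N 0 x ^ 2)]

lemma memLp_gaussDensity (N : ℕ) (b : EuclideanSpace ℝ (Fin N)) :
    MemLp (gaussDensity N b) 2 := by
  rw [memLp_two_iff_integrable_sq (continuous_gaussDensity N b).aestronglyMeasurable]
  simpa only [sq] using integrable_gaussDensity_mul N b b

lemma integral_gaussDensity_sq (N : ℕ) (b : EuclideanSpace ℝ (Fin N)) :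
    ∫ x, gaussDensity N b x ^ 2 = ∫ x, gaussDensity N 0 x ^ 2 := by
  simpa [sq] using integral_gaussDensity_mul N b b

/-- The translation map `b ↦ gaussDensity N b` is Lipschitz into `L²`. -/
lemma integral_gaussDensity_sub_sq_le (N : ℕ) (b c : EuclideanSpace ℝ (Fin N)) :
    ∫ x, (gaussDensity N b x - gaussDensity N c x) ^ 2 ≤
      (∫ x, gaussDensity N 0 x ^ 2) * ‖b - c‖ ^ 2 := by
  have hM : 0 ≤ ∫ x, gaussDensity N 0 x ^ 2 := integral_nonneg fun x => sq_nonneg _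
  have hb := (memLp_gaussDensity N b).integrable_sq
  have hc := (memLp_gaussDensity N c).integrable_sq
  have hbc := (integrable_gaussDensity_mul N b c).const_mul 2
  have expand : ∀ x, (gaussDensity N b x - gaussDensity N c x) ^ 2 =
      gaussDensity N b x ^ 2 + gaussDensity N c x ^ 2
        - 2 * (gaussDensity N b x * gaussDensity N c x) := fun x => by ring
  simp only [expand]
  rw [integral_sub (by exact hb.add hc) hbc, integral_add hb hc, integral_const_mul,
    integral_gaussDensity_mul, integral_gaussDensity_sq N b, integral_gaussDensity_sq N c]
  nlinarith [mul_nonneg hM (sub_nonneg.2 (Real.add_one_le_exp (-‖b - c‖ ^ 2 / 4))),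
    mul_nonneg hM (sq_nonneg ‖b - c‖)]

lemma integral_sum_mul_sq_le {α ι : Type*} [MeasurableSpace α] {μ : Measure α} (s : Finset ι)
    (c : ι → ℝ) (g : ι → α → ℝ) (hg : ∀ k ∈ s, MemLp (g k) 2 μ) :
    ∫ x, (∑ k ∈ s, c k * g k x) ^ 2 ∂μ ≤ s.card * ∑ k ∈ s, c k ^ 2 * ∫ x, g k x ^ 2 ∂μ := by
  have hint : ∀ k ∈ s, Integrable (fun x => c k ^ 2 * g k x ^ 2) μ :=
    fun k hk => (hg k hk).integrable_sq.const_mul _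
  calc ∫ x, (∑ k ∈ s, c k * g k x) ^ 2 ∂μ
      ≤ ∫ x, s.card * ∑ k ∈ s, c k ^ 2 * g k x ^ 2 ∂μ := by
        refine integral_mono (memLp_finsetSum s fun k hk => (hg k hk).const_mul (c k)).integrable_sq
          ((integrable_finsetSum s hint).const_mul _) fun x => ?_
        simpa only [mul_pow] using sq_sum_le_card_mul_sum_sq (s := s) (f := fun k => c k * g k x)
    _ = _ := by
        rw [integral_const_mul, integral_finsetSum s hint]
        simp only [integral_const_mul]

/-- near the true parameter, the squared `L²` distance between the Gaussian
mixture density `p(·|w)` and the true density `q` is bounded by a constant multiple of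
`Σ_{k=2}^{K*}(a_k−a*_k)² + Σ_{k=K*+1}^{K} a_k² + Σ_{k=1}^{K*}‖b_k−b*_k‖²`.
Components are indexed by `k ∈ {1, …, K}`; `b_k` is arbitrary for `k > K*`. -/
theorem gaussian_mixture_L2_upper_bound
    (N Kstar K : ℕ) (hKstar : 1 ≤ Kstar) (hK : Kstar < K)
    (astar : ℕ → ℝ) (hastar_pos : ∀ k ∈ Finset.Icc 1 Kstar, 0 < astar k)
    (hastar_sum : ∑ k ∈ Finset.Icc 1 Kstar, astar k = 1)
    (bstar : ℕ → EuclideanSpace ℝ (Fin N)) :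
    ∃ ε > (0 : ℝ), ∃ C : ℝ, 0 < C ∧
      ∀ (a : ℕ → ℝ) (b : ℕ → EuclideanSpace ℝ (Fin N)),
        (∑ k ∈ Finset.Icc 1 K, a k = 1) →
        (∀ k ∈ Finset.Icc 2 Kstar, |a k - astar k| < ε) →
        (∀ k ∈ Finset.Icc (Kstar + 1) K, 0 ≤ a k ∧ a k < ε) →
        (∀ k ∈ Finset.Icc 1 Kstar, ‖b k - bstar k‖ < ε) →
        (∫ x : EuclideanSpace ℝ (Fin N),
            ((∑ k ∈ Finset.Icc 1 K, a k * gaussDensity N (b k) x) -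
              ∑ k ∈ Finset.Icc 1 Kstar, astar k * gaussDensity N (bstar k) x) ^ 2) ≤
          C * (∑ k ∈ Finset.Icc 2 Kstar, (a k - astar k) ^ 2 +
            ∑ k ∈ Finset.Icc (Kstar + 1) K, a k ^ 2 +
            ∑ k ∈ Finset.Icc 1 Kstar, ‖b k - bstar k‖ ^ 2) := by
  set M := ∫ x, gaussDensity N 0 x ^ 2 with hM_def
  have hM : 0 ≤ M := integral_nonneg fun x => sq_nonneg _
  refine ⟨1, one_pos, 6 * K * M * (K + 1) + 1, by positivity, fun a b ha _ _ _ => ?_⟩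
  have split : ∀ f : ℕ → ℝ, ∑ k ∈ Finset.Icc 1 K, f k =
      ∑ k ∈ Finset.Icc 1 Kstar, f k + ∑ k ∈ Finset.Icc (Kstar + 1) K, f k := fun f => by
    simpa only [← Finset.Ico_add_one_right_eq_Icc] using
      (Finset.sum_Ico_consecutive f (by omega : 1 ≤ Kstar + 1) (by omega : Kstar + 1 ≤ K + 1)).symm
  have split_first : ∀ f : ℕ → ℝ, ∑ k ∈ Finset.Icc 1 Kstar, f k =
      f 1 + ∑ k ∈ Finset.Icc 2 Kstar, f k := fun f => by
    simpa only [← Finset.Ico_add_one_right_eq_Icc] using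
      Finset.sum_eq_sum_Ico_succ_bot (by omega : 1 < Kstar + 1) f
  set S₁ := ∑ k ∈ Finset.Icc 2 Kstar, (a k - astar k) ^ 2
  set S₂ := ∑ k ∈ Finset.Icc (Kstar + 1) K, a k ^ 2
  set S₃ := ∑ k ∈ Finset.Icc 1 Kstar, ‖b k - bstar k‖ ^ 2
  have hS₁ : 0 ≤ S₁ := Finset.sum_nonneg fun _ _ => sq_nonneg _
  have hS₂ : 0 ≤ S₂ := Finset.sum_nonneg fun _ _ => sq_nonneg _
  have hS₃ : 0 ≤ S₃ := Finset.sum_nonneg fun _ _ => sq_nonneg _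
  have hKK : (Kstar : ℝ) ≤ K := by exact_mod_cast hK.le
  have card₂ : ((Finset.Icc 2 Kstar).card : ℝ) ≤ K := by
    rw [Nat.card_Icc]; exact_mod_cast (by omega : Kstar + 1 - 2 ≤ K)
  have card₃ : ((Finset.Icc (Kstar + 1) K).card : ℝ) ≤ K := by
    rw [Nat.card_Icc]; exact_mod_cast (by omega : K + 1 - (Kstar + 1) ≤ K)
  have first_weight : (a 1 - astar 1) ^ 2 ≤ 2 * K * (S₁ + S₂) := by
    have e : a 1 - astar 1 = -(∑ k ∈ Finset.Icc 2 Kstar, (a k - astar k) +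
        ∑ k ∈ Finset.Icc (Kstar + 1) K, a k) := by
      rw [Finset.sum_sub_distrib]
      linarith [split a, split_first a, split_first astar]
    have h1 : (∑ k ∈ Finset.Icc 2 Kstar, (a k - astar k)) ^ 2 ≤ K * S₁ :=
      sq_sum_le_card_mul_sum_sq.trans (mul_le_mul_of_nonneg_right card₂ hS₁)
    have h2 : (∑ k ∈ Finset.Icc (Kstar + 1) K, a k) ^ 2 ≤ K * S₂ :=
      sq_sum_le_card_mul_sum_sq.trans (mul_le_mul_of_nonneg_right card₃ hS₂)
    rw [e, neg_sq]
    linarith [add_sq_le (a := ∑ k ∈ Finset.Icc 2 Kstar, (a k - astar k))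
      (b := ∑ k ∈ Finset.Icc (Kstar + 1) K, a k)]
  have astar_sq_le : ∀ k ∈ Finset.Icc 1 Kstar, astar k ^ 2 ≤ 1 := fun k hk =>
    pow_le_one₀ (hastar_pos k hk).le <| hastar_sum ▸
      Finset.single_le_sum (fun i hi => (hastar_pos i hi).le) hk
  set A := fun x => ∑ k ∈ Finset.Icc 1 Kstar, (a k - astar k) * gaussDensity N (b k) x
  set B := fun x => ∑ k ∈ Finset.Icc 1 Kstar,
    astar k * (gaussDensity N (b k) x - gaussDensity N (bstar k) x)
  set D := fun x => ∑ k ∈ Finset.Icc (Kstar + 1) K, a k * gaussDensity N (b k) x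
  have hA : MemLp A 2 := memLp_finsetSum _ fun k _ => (memLp_gaussDensity N (b k)).const_mul _
  have hB : MemLp B 2 := memLp_finsetSum _ fun k _ =>
    ((memLp_gaussDensity N (b k)).sub (memLp_gaussDensity N (bstar k))).const_mul _
  have hD : MemLp D 2 := memLp_finsetSum _ fun k _ => (memLp_gaussDensity N (b k)).const_mul _
  have decomp : ∀ x, (∑ k ∈ Finset.Icc 1 K, a k * gaussDensity N (b k) x) -
      ∑ k ∈ Finset.Icc 1 Kstar, astar k * gaussDensity N (bstar k) x = A x + B x + D x := by
    intro x
    simp only [A, B, D, split, sub_mul, mul_sub, Finset.sum_sub_distrib]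
    ring
  have boundA : ∫ x, A x ^ 2 ≤ K * (((2 * K + 1) * (S₁ + S₂)) * M) := by
    refine (integral_sum_mul_sq_le _ _ _ fun k _ => memLp_gaussDensity N (b k)).trans ?_
    simp only [integral_gaussDensity_sq N (b _), ← hM_def]
    rw [← Finset.sum_mul, split_first, Nat.card_Icc, Nat.add_sub_cancel]
    gcongr
    linarith
  have boundB : ∫ x, B x ^ 2 ≤ K * (M * S₃) := by
    refine (integral_sum_mul_sq_le _ _ (fun k x => gaussDensity N (b k) x -
      gaussDensity N (bstar k) x) fun k _ =>
      (memLp_gaussDensity N (b k)).sub (memLp_gaussDensity N (bstar k))).trans ?_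
    rw [Nat.card_Icc, Nat.add_sub_cancel, Finset.mul_sum _ _ M]
    refine mul_le_mul hKK (Finset.sum_le_sum fun k hk => ?_) (Finset.sum_nonneg fun k _ =>
      mul_nonneg (sq_nonneg _) (integral_nonneg fun x => sq_nonneg _)) (Nat.cast_nonneg K)
    exact (mul_le_of_le_one_left (integral_nonneg fun x => sq_nonneg _) (astar_sq_le k hk)).trans
      (integral_gaussDensity_sub_sq_le N (b k) (bstar k))
  have boundD : ∫ x, D x ^ 2 ≤ K * (S₂ * M) := by
    refine (integral_sum_mul_sq_le _ _ _ fun k _ => memLp_gaussDensity N (b k)).trans ?_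
    simp only [integral_gaussDensity_sq N (b _), ← hM_def]
    rw [← Finset.sum_mul]
    gcongr
  simp only [decomp]
  have hABD := ((hA.integrable_sq.add hB.integrable_sq).add hD.integrable_sq).const_mul 3
  calc ∫ x, (A x + B x + D x) ^ 2
      ≤ ∫ x, 3 * (A x ^ 2 + B x ^ 2 + D x ^ 2) :=
        integral_mono ((hA.add hB).add hD).integrable_sq hABD fun x => by
          change (A x + B x + D x) ^ 2 ≤ 3 * (A x ^ 2 + B x ^ 2 + D x ^ 2)
          nlinarith [sq_nonneg (A x - B x), sq_nonneg (B x - D x), sq_nonneg (A x - D x)]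
    _ = 3 * ((∫ x, A x ^ 2) + (∫ x, B x ^ 2) + ∫ x, D x ^ 2) := by
        rw [integral_const_mul, integral_add (by exact hA.integrable_sq.add hB.integrable_sq)
          hD.integrable_sq, integral_add hA.integrable_sq hB.integrable_sq]
    _ ≤ 3 * (K * (((2 * K + 1) * (S₁ + S₂)) * M) + K * (M * S₃) + K * (S₂ * M)) := by gcongr
    _ ≤ (6 * K * M * (K + 1) + 1) * (S₁ + S₂ + S₃) := by
        have hKM : 0 ≤ K * M := by positivity
        nlinarith [mul_nonneg hKM hS₁, mul_nonneg hKM hS₂, mul_nonneg hKM hS₃,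
          mul_nonneg (Nat.cast_nonneg (α := ℝ) K) (mul_nonneg hKM hS₃)]
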